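/- For every admissible z ∈ ℂ at which the d×d matrix G(z) is invertible, the finite-temperature self-energy Σ(z) := z·I_d − h − G(z)⁻¹ satisfies Σ_{ij}(z) = 0 whenever i > p or j > p; that is, Σ(z) has nonzero entries only in its upper-left p×p block. -/

import Mathlib

open scoped InnerProductSpace
open ContinuousLinearMap

section CanonicalAnticommutation

variable {n R : Type*} [Fintype n] [DecidableEq n] [Ring R] [Algebra ℂ R]

/-- The commutator of an annihilation operator with a quadratic operator. -/
theorem annihilation_commutator_quadratic {a b : n → R}
    (haa : ∀ i j, a i * a j + a j * a i = 0)
    (hab : ∀ i j, a i * b j + b j * a i = if i = j then 1 else 0)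
    (h : Matrix n n ℂ) (i : n) :
    a i * (∑ k, ∑ l, h k l • (b k * a l)) - (∑ k, ∑ l, h k l • (b k * a l)) * a i =
      ∑ l, h i l • a l := by
  have key (k l : n) :
      a i * (b k * a l) - b k * a l * a i = (if i = k then 1 else 0) * a l := by
    rw [← hab, mul_assoc (b k), eq_neg_of_add_eq_zero_left (haa l i)]
    simp only [mul_neg, add_mul, mul_assoc]
    abel
  simp only [Finset.mul_sum, Finset.sum_mul, ← Finset.sum_sub_distrib, mul_smul_comm,
    smul_mul_assoc, ← smul_sub, key]
  simp [ite_mul, smul_ite]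

/-- The commutator of a creation operator with a quadratic operator. -/
theorem creation_commutator_quadratic {a b : n → R}
    (hbb : ∀ i j, b i * b j + b j * b i = 0)
    (hab : ∀ i j, a i * b j + b j * a i = if i = j then 1 else 0)
    (h : Matrix n n ℂ) (j : n) :
    b j * (∑ k, ∑ l, h k l • (b k * a l)) - (∑ k, ∑ l, h k l • (b k * a l)) * b j =
      -∑ k, h k j • b k := by
  have key (k l : n) :
      b j * (b k * a l) - b k * a l * b j = -(b k * (if l = j then 1 else 0)) := by
    rw [← hab, ← mul_assoc (b j), eq_neg_of_add_eq_zero_left (hbb j k)]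
    simp only [neg_mul, mul_add, mul_assoc]
    abel
  simp only [Finset.mul_sum, Finset.sum_mul, ← Finset.sum_sub_distrib, mul_smul_comm,
    smul_mul_assoc, ← smul_sub, key]
  simp [mul_ite, smul_ite]

end CanonicalAnticommutation

section Resolvent

variable {V : Type*} [NormedAddCommGroup V] [InnerProductSpace ℂ V]

/-- Equation of motion for a resolvent expectation value, moving an operator on the left of the
resolvent across the Hamiltonian. -/
theorem inner_mul_inverse_mul_left {K A B : V →L[ℂ] V} {v : V} {z ε : ℂ}
    (hv : ∀ x, ⟪v, K x⟫_ℂ = 0) (hW : IsUnit (z • (1 : V →L[ℂ] V) + ε • K)) :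
    z * ⟪v, (A * Ring.inverse (z • (1 : V →L[ℂ] V) + ε • K) * B) v⟫_ℂ =
      ⟪v, (A * B) v⟫_ℂ -
        ε * ⟪v, ((A * K - K * A) * Ring.inverse (z • (1 : V →L[ℂ] V) + ε • K) * B) v⟫_ℂ := by
  have hinv := Ring.mul_inverse_cancel _ hW
  generalize Ring.inverse (z • (1 : V →L[ℂ] V) + ε • K) = S at *
  have hS : z • S = 1 - ε • (K * S) := by
    rw [← hinv, add_mul, smul_mul_assoc, one_mul, smul_mul_assoc]; abel
  have hop : z • (A * S * B) = A * B - ε • ((A * K - K * A) * S * B) - ε • (K * (A * S * B)) := by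
    rw [← smul_mul_assoc, ← mul_smul_comm, hS]
    simp only [mul_sub, sub_mul, mul_one, mul_smul_comm, smul_mul_assoc, smul_sub, mul_assoc]
    abel
  have := congrArg (fun T : V →L[ℂ] V => ⟪v, T v⟫_ℂ) hop
  simpa [hv, inner_sub_right, inner_smul_right] using this

/-- Equation of motion for a resolvent expectation value, moving an operator on the right of the
resolvent across the Hamiltonian. -/
theorem inner_mul_inverse_mul_right {K A B : V →L[ℂ] V} {v : V} {z ε : ℂ}
    (hv : K v = 0) (hW : IsUnit (z • (1 : V →L[ℂ] V) + ε • K)) :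
    z * ⟪v, (B * Ring.inverse (z • (1 : V →L[ℂ] V) + ε • K) * A) v⟫_ℂ =
      ⟪v, (B * A) v⟫_ℂ +
        ε * ⟪v, (B * Ring.inverse (z • (1 : V →L[ℂ] V) + ε • K) * (A * K - K * A)) v⟫_ℂ := by
  have hinv := Ring.inverse_mul_cancel _ hW
  generalize Ring.inverse (z • (1 : V →L[ℂ] V) + ε • K) = S at *
  have hS : z • S = 1 - ε • (S * K) := by
    rw [← hinv, mul_add, mul_smul_comm, mul_one, mul_smul_comm]; abel
  have hop : z • (B * S * A) = B * A + ε • (B * S * (A * K - K * A)) - ε • (B * S * A * K) := by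
    rw [← smul_mul_assoc, ← mul_smul_comm, hS]
    simp only [mul_sub, sub_mul, mul_one, mul_smul_comm, smul_mul_assoc, smul_sub, mul_assoc]
    abel
  have := congrArg (fun T : V →L[ℂ] V => ⟪v, T v⟫_ℂ) hop
  simpa [hv, inner_sub_right, inner_add_right, inner_smul_right] using this

end Resolvent

/-- **Sparsity of the finite-temperature self-energy (Theorem 3.3, fermionic case).**
For an impurity Hamiltonian with fragment `{1,…,p}`, the finite-temperature
self-energy `Σ(z) = z·I − h − G(z)⁻¹` vanishes outside the upper-left
`p × p` block. -/
theorem finite_temperature_self_energy_sparsity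
    (d p : ℕ) (V : Type*) [NormedAddCommGroup V] [InnerProductSpace ℂ V]
    [FiniteDimensional ℂ V]
    (a : Fin d → (V →L[ℂ] V))
    (hcar1 : ∀ i j : Fin d, a i * a j + a j * a i = 0)
    (hcar2 : ∀ i j : Fin d,
      a i * adjoint (a j) + adjoint (a j) * a i = if i = j then 1 else 0)
    (h : Matrix (Fin d) (Fin d) ℂ) (hh : h.IsHermitian)
    (Uop : V →L[ℂ] V) (hUsa : IsSelfAdjoint Uop)
    (hUcomm : ∀ j : Fin d, p ≤ (j : ℕ) →
      Uop * a j = a j * Uop ∧ Uop * adjoint (a j) = adjoint (a j) * Uop)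
    (H : V →L[ℂ] V)
    (hHdef : H = (∑ i, ∑ j, h i j • (adjoint (a i) * a j)) + Uop)
    (Nop : V →L[ℂ] V) (hNdef : Nop = ∑ i, adjoint (a i) * a i)
    (hHN : H * Nop = Nop * H)
    (ι : Type*) [Fintype ι]
    (ψ : OrthonormalBasis ι ℂ V)
    (E N : ι → ℝ)
    (hE : ∀ m : ι, H (ψ m) = (E m : ℂ) • ψ m)
    (hN : ∀ m : ι, Nop (ψ m) = (N m : ℂ) • ψ m)
    (β μ : ℝ) (hβ : 0 < β)
    (Z : ℝ) (hZdef : Z = ∑ m : ι, Real.exp (-β * (E m - μ * N m)))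
    (z : ℂ)
    (hz1 : ∀ m : ι, IsUnit (z • (1 : V →L[ℂ] V) - (H - (E m : ℂ) • 1)))
    (hz2 : ∀ m : ι, IsUnit (z • (1 : V →L[ℂ] V) + (H - (E m : ℂ) • 1)))
    (G : Matrix (Fin d) (Fin d) ℂ)
    (hGdef : ∀ i j : Fin d, G i j = (1 / (Z : ℂ)) *
      ∑ m : ι, (Real.exp (-β * (E m - μ * N m)) : ℂ) *
        (⟪ψ m, ((a i * Ring.inverse (z • (1 : V →L[ℂ] V) - (H - (E m : ℂ) • 1)) *
            adjoint (a j)) (ψ m))⟫_ℂ +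
         ⟪ψ m, ((adjoint (a j) * Ring.inverse (z • (1 : V →L[ℂ] V) + (H - (E m : ℂ) • 1)) *
            a i) (ψ m))⟫_ℂ))
    (hGinv : IsUnit G.det) :
    ∀ i j : Fin d, (p ≤ (i : ℕ) ∨ p ≤ (j : ℕ)) →
      (z • (1 : Matrix (Fin d) (Fin d) ℂ) - h - G⁻¹) i j = 0 := by
  have hHadj (m : ι) (x : V) : ⟪ψ m, H x⟫_ℂ = E m * ⟪ψ m, x⟫_ℂ := by
    have : (innerSL ℂ (ψ m) ∘L H : V →ₗ[ℂ] ℂ) = ((E m : ℂ) • innerSL ℂ (ψ m) : V →L[ℂ] ℂ) := by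
      classical
      refine ψ.toBasis.ext fun n => ?_
      by_cases hmn : m = n
      · subst hmn; simp [hE, inner_smul_right, -Complex.coe_smul]
      · simp [hE, inner_smul_right, ψ.inner_eq_ite, hmn, -Complex.coe_smul]
    simpa using LinearMap.congr_fun this x
  set w : ι → ℝ := fun m => Real.exp (-β * (E m - μ * N m))
  set K : ι → V →L[ℂ] V := fun m => H - (E m : ℂ) • 1 with hK
  have hKψ (m : ι) : K m (ψ m) = 0 := by simp [hK, hE]
  have hKadj (m : ι) (x : V) : ⟪ψ m, K m x⟫_ℂ = 0 := by
    simp [hK, hHadj, -Complex.coe_smul]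
  have hKcomm (m : ι) (A : V →L[ℂ] V) : A * K m - K m * A = A * H - H * A := by
    simp only [hK, mul_sub, sub_mul, mul_smul_comm, smul_mul_assoc, mul_one, one_mul]
    abel
  have hminus (m : ι) : z • (1 : V →L[ℂ] V) - K m = z • 1 + (-1 : ℂ) • K m := by
    rw [neg_one_smul, sub_eq_add_neg]
  have hplus (m : ι) : z • (1 : V →L[ℂ] V) + K m = z • 1 + (1 : ℂ) • K m := by
    rw [one_smul]
  have hbb (i j : Fin d) :
      adjoint (a i) * adjoint (a j) + adjoint (a j) * adjoint (a i) = 0 := by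
    simpa [← star_eq_adjoint] using congrArg star (hcar1 j i)
  have hcomm (i : Fin d) (hi : p ≤ (i : ℕ)) : a i * H - H * a i = ∑ k, h i k • a k := by
    rw [← annihilation_commutator_quadratic hcar1 hcar2, hHdef, mul_add, add_mul,
      (hUcomm i hi).1, add_sub_add_right_eq_sub]
  have hcomm' (j : Fin d) (hj : p ≤ (j : ℕ)) :
      adjoint (a j) * H - H * adjoint (a j) = -∑ k, h k j • adjoint (a k) := by
    rw [← creation_commutator_quadratic (a := a) hbb hcar2, hHdef, mul_add, add_mul,
      (hUcomm j hj).2, add_sub_add_right_eq_sub]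
  set F : ι → Fin d → Fin d → ℂ := fun m i j =>
    ⟪ψ m, (a i * Ring.inverse (z • (1 : V →L[ℂ] V) - K m) * adjoint (a j)) (ψ m)⟫_ℂ +
      ⟪ψ m, (adjoint (a j) * Ring.inverse (z • (1 : V →L[ℂ] V) + K m) * a i) (ψ m)⟫_ℂ with hF
  have hG (i j : Fin d) : G i j = 1 / (Z : ℂ) * ∑ m, (w m : ℂ) * F m i j := hGdef i j
  have hδ (m : ι) (i j : Fin d) :
      ⟪ψ m, (a i * adjoint (a j)) (ψ m)⟫_ℂ + ⟪ψ m, (adjoint (a j) * a i) (ψ m)⟫_ℂ =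
        (1 : Matrix (Fin d) (Fin d) ℂ) i j := by
    rw [← inner_add_right, ← add_apply, hcar2, Matrix.one_apply]
    split_ifs <;> simp
  have hFrow (m : ι) (i j : Fin d) (hi : p ≤ (i : ℕ)) :
      z * F m i j = (1 : Matrix (Fin d) (Fin d) ℂ) i j + ∑ k, h i k * F m k j := by
    have h1 := hz1 m
    have h2 := hz2 m
    change IsUnit (z • (1 : V →L[ℂ] V) - K m) at h1
    change IsUnit (z • (1 : V →L[ℂ] V) + K m) at h2
    simp only [hF, mul_add, Finset.sum_add_distrib, ← hδ m]
    rw [hminus] at h1 ⊢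
    rw [hplus] at h2 ⊢
    rw [inner_mul_inverse_mul_left (hKadj m) h1, inner_mul_inverse_mul_right (hKψ m) h2,
      hKcomm, hcomm i hi]
    simp only [Finset.sum_mul, Finset.mul_sum, smul_mul_assoc, mul_smul_comm, sum_apply,
      smul_apply, inner_sum, inner_smul_right, one_mul,
      neg_mul, Finset.sum_neg_distrib]
    ring
  have hFcol (m : ι) (i j : Fin d) (hj : p ≤ (j : ℕ)) :
      z * F m i j = (1 : Matrix (Fin d) (Fin d) ℂ) i j + ∑ k, h k j * F m i k := by
    have h1 := hz1 m
    have h2 := hz2 m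
    change IsUnit (z • (1 : V →L[ℂ] V) - K m) at h1
    change IsUnit (z • (1 : V →L[ℂ] V) + K m) at h2
    simp only [hF, mul_add, Finset.sum_add_distrib, ← hδ m]
    rw [hminus] at h1 ⊢
    rw [hplus] at h2 ⊢
    rw [inner_mul_inverse_mul_right (hKψ m) h1, inner_mul_inverse_mul_left (hKadj m) h2,
      hKcomm, hcomm' j hj]
    simp only [neg_mul, mul_neg, one_mul, Finset.sum_neg_distrib, neg_apply,
      inner_neg_right, Finset.sum_mul, Finset.mul_sum, smul_mul_assoc, mul_smul_comm, sum_apply, smul_apply, inner_sum, inner_smul_right]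
    ring
  intro i j hij
  have hZ : (Z : ℂ) ≠ 0 := by
    intro hZ
    have hG0 : G = 0 := by ext k l; simp [hG, hZ]
    have : Nonempty (Fin d) := ⟨i⟩
    simp [hG0] at hGinv
  have hwZ : 1 / (Z : ℂ) * ∑ m, (w m : ℂ) = 1 := by
    rw [← Complex.ofReal_sum, ← hZdef, one_div, inv_mul_cancel₀ hZ]
  have average {c : Fin d → ℂ} {f : ι → ℂ} {g : ι → Fin d → ℂ} {δ : ℂ}
      (hfg : ∀ m, z * f m = δ + ∑ k, c k * g m k) :
      z * (1 / (Z : ℂ) * ∑ m, (w m : ℂ) * f m) =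
        δ + ∑ k, c k * (1 / (Z : ℂ) * ∑ m, (w m : ℂ) * g m k) := by
    calc _ = 1 / (Z : ℂ) * ∑ m, (w m : ℂ) * (z * f m) := by
            simp only [Finset.mul_sum]; exact Finset.sum_congr rfl fun m _ => by ring
      _ = (1 / (Z : ℂ) * ∑ m, (w m : ℂ)) * δ +
            1 / (Z : ℂ) * ∑ m, ∑ k, (w m : ℂ) * (c k * g m k) := by
          simp only [hfg, mul_add, Finset.sum_add_distrib, Finset.mul_sum, Finset.sum_mul,
            mul_assoc]
      _ = _ := by
          rw [hwZ, one_mul, Finset.sum_comm]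
          simp only [Finset.mul_sum]
          refine congrArg _ (Finset.sum_congr rfl fun k _ => ?_)
          exact Finset.sum_congr rfl fun m _ => by ring
  rcases hij with hi | hj
  · have hrow (l : Fin d) : ((z • 1 - h) * G) i l = (1 : Matrix (Fin d) (Fin d) ℂ) i l := by
      rw [sub_mul, smul_mul_assoc, one_mul, Matrix.sub_apply, Matrix.smul_apply, smul_eq_mul,
        Matrix.mul_apply, sub_eq_iff_eq_add]
      simpa only [hG] using average fun m => hFrow m i l hi
    have : z • 1 - h - G⁻¹ = ((z • 1 - h) * G - 1) * G⁻¹ := by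
      rw [sub_mul, one_mul, Matrix.mul_nonsing_inv_cancel_right _ _ hGinv]
    rw [this, Matrix.mul_apply]
    simp [Matrix.sub_apply, hrow]
  · have hcol (l : Fin d) : (G * (z • 1 - h)) l j = (1 : Matrix (Fin d) (Fin d) ℂ) l j := by
      rw [mul_sub, mul_smul_comm, mul_one, Matrix.sub_apply, Matrix.smul_apply, smul_eq_mul,
        Matrix.mul_apply, sub_eq_iff_eq_add]
      simp only [mul_comm (G l _)]
      simpa only [hG] using average fun m => hFcol m l j hj
    have : z • 1 - h - G⁻¹ = G⁻¹ * (G * (z • 1 - h) - 1) := by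
      rw [mul_sub, mul_one, Matrix.nonsing_inv_mul_cancel_left _ _ hGinv]
    rw [this, Matrix.mul_apply]
    simp [Matrix.sub_apply, hcol]
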